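/- Let V be a real vector space, B : ℕ → V, and p ≥ 2 a natural number. Suppose the family S : ℕ → ℕ → V satisfies S(m,0) = 0^m • B(0) and S(m,k+1) = S(m,k) + (k+1)^m • B(k+1) for all m and k, and suppose L : ℕ → V satisfies L(0) = B(0) and L(k+1) = L(k) + B(k+1) + ∑_{m=0}^{p−2} c_m^p(k+1) • S(m,k) for all k. Then for every k: S(m,k) = ∑_{l=0}^{k} l^m • B(l) and L(k) = ∑_{l=0}^{k} ((k+1−l)^p − (k−l)^p) • B(l). Here c_m^p(k) := C(p,m)·((k−1)^{p−m} − 2·k^{p−m} + (k+1)^{p−m})·(−1)^m and the convention 0^0 = 1 is used. -/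

import Mathlib

/-- The coefficient `c_m^p(k) = C(p,m)·((k−1)^{p−m} − 2·k^{p−m} + (k+1)^{p−m})·(−1)^m`. -/
def ccoef (p m : ℕ) (k : ℤ) : ℤ :=
  (p.choose m : ℤ) * ((k - 1) ^ (p - m) - 2 * k ^ (p - m) + (k + 1) ^ (p - m)) * (-1) ^ m

theorem sum_ccoef_mul_pow (p : ℕ) (hp : 2 ≤ p) (k : ℤ) (x : ℝ) :
    ∑ m ∈ Finset.range (p - 1), (ccoef p m k : ℝ) * x ^ m
      = ((k : ℝ) + 1 - x) ^ p - 2 * ((k : ℝ) - x) ^ p + ((k : ℝ) - 1 - x) ^ p := by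
  obtain ⟨q, rfl⟩ := Nat.exists_eq_add_of_le' hp
  have expand (y : ℝ) : (y - x) ^ (q + 2) = ∑ m ∈ Finset.range (q + 3),
      ((q + 2).choose m : ℝ) * y ^ (q + 2 - m) * (-1) ^ m * x ^ m := by
    rw [sub_eq_neg_add, add_pow]
    refine Finset.sum_congr rfl fun m _ => ?_
    rw [neg_pow]
    ring
  have full : ∑ m ∈ Finset.range (q + 3), (ccoef (q + 2) m k : ℝ) * x ^ m
      = ((k : ℝ) + 1 - x) ^ (q + 2) - 2 * ((k : ℝ) - x) ^ (q + 2)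
        + ((k : ℝ) - 1 - x) ^ (q + 2) := by
    rw [expand, expand, expand, Finset.mul_sum, ← Finset.sum_sub_distrib,
      ← Finset.sum_add_distrib]
    refine Finset.sum_congr rfl fun m _ => ?_
    simp only [ccoef]
    push_cast
    ring
  have top : ccoef (q + 2) (q + 2) k = 0 := by simp [ccoef]
  have subtop : ccoef (q + 2) (q + 1) k = 0 := by
    have h : q + 2 - (q + 1) = 1 := by omega
    simp only [ccoef, h]
    ring
  rw [← full, Finset.sum_range_succ, Finset.sum_range_succ, top, subtop]
  simp

theorem m2l_recurrences_correct
    {V : Type*} [AddCommGroup V] [Module ℝ V] (B : ℕ → V) (p : ℕ) (hp : 2 ≤ p)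
    (S : ℕ → ℕ → V) (L : ℕ → V)
    (hS0 : ∀ m, S m 0 = ((0 : ℝ) ^ m) • B 0)
    (hSrec : ∀ m k, S m (k + 1) = S m k + (((k : ℝ) + 1) ^ m) • B (k + 1))
    (hL0 : L 0 = B 0)
    (hLrec : ∀ k, L (k + 1) = L k + B (k + 1)
      + ∑ m ∈ Finset.range (p - 1), ((ccoef p m ((k : ℤ) + 1) : ℝ)) • S m k) :
    (∀ m k, S m k = ∑ l ∈ Finset.range (k + 1), ((l : ℝ) ^ m) • B l) ∧
    (∀ k, L k = ∑ l ∈ Finset.range (k + 1),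
      ((((k : ℝ) + 1 - l) ^ p - ((k : ℝ) - l) ^ p)) • B l) := by
  have hS : ∀ m k, S m k = ∑ l ∈ Finset.range (k + 1), ((l : ℝ) ^ m) • B l := by
    intro m k
    induction k with
    | zero => simp [hS0]
    | succ k ih => rw [hSrec, ih, Finset.sum_range_succ _ (k + 1), Nat.cast_succ]
  refine ⟨hS, fun k => ?_⟩
  have hp0 : p ≠ 0 := by omega
  induction k with
  | zero => simp [hL0, hp0]
  | succ k ih =>
    have hsum : ∑ m ∈ Finset.range (p - 1), ((ccoef p m ((k : ℤ) + 1) : ℝ)) • S m k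
        = ∑ l ∈ Finset.range (k + 1), (((k : ℝ) + 1 + 1 - l) ^ p
          - 2 * ((k : ℝ) + 1 - l) ^ p + ((k : ℝ) - l) ^ p) • B l := by
      simp only [hS, Finset.smul_sum, smul_smul]
      rw [Finset.sum_comm]
      refine Finset.sum_congr rfl fun l _ => ?_
      rw [← Finset.sum_smul, sum_ccoef_mul_pow p hp]
      simp
    have hlast : (((k + 1 : ℕ) : ℝ) + 1 - (k + 1 : ℕ)) ^ p
        - (((k + 1 : ℕ) : ℝ) - (k + 1 : ℕ)) ^ p = 1 := by
      simp [hp0]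
    rw [hLrec, ih, hsum, Finset.sum_range_succ _ (k + 1), hlast, one_smul, add_right_comm,
      ← Finset.sum_add_distrib]
    congr 1
    refine Finset.sum_congr rfl fun l _ => ?_
    rw [← add_smul]
    congr 1
    push_cast
    ring
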